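/- Let a110, a101, a011, a100, a010, a001, a000 and their primed counterparts and g be smooth real functions on ℝ³, and define L u = ∂_x∂_y∂_z u + a110·∂_x∂_y u + a101·∂_x∂_z u + a011·∂_y∂_z u + a100·∂_x u + a010·∂_y u + a001·∂_z u + a000·u, and L' analogously with the primed coefficients. If L' u = e^{−g}·L(e^{g}·u) for every smooth u : ℝ³ → ℝ, then the symmetric constant-term invariant agrees: a000' − (a100'·a011' + a010'·a101' + a001'·a110' − 2·a011'·a101'·a110' + (∂_x∂_y a110' + ∂_x∂_z a101' + ∂_y∂_z a011')/3) = a000 − (a100·a011 + a010·a101 + a001·a110 − 2·a011·a101·a110 + (∂_x∂_y a110 + ∂_x∂_z a101 + ∂_y∂_z a011)/3). -/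

import Mathlib

noncomputable def dx (f : (Fin 3 → ℝ) → ℝ) : (Fin 3 → ℝ) → ℝ :=
  fun p => fderiv ℝ f p (Pi.single 0 1)

noncomputable def dy (f : (Fin 3 → ℝ) → ℝ) : (Fin 3 → ℝ) → ℝ :=
  fun p => fderiv ℝ f p (Pi.single 1 1)

noncomputable def dz (f : (Fin 3 → ℝ) → ℝ) : (Fin 3 → ℝ) → ℝ :=
  fun p => fderiv ℝ f p (Pi.single 2 1)

/-- The derivative of `f` in the constant direction `v`, as a function of the base point. -/
noncomputable def dirDeriv (v : Fin 3 → ℝ) (f : (Fin 3 → ℝ) → ℝ) : (Fin 3 → ℝ) → ℝ :=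
  fun p => fderiv ℝ f p v

section dirDeriv

variable {f g u : (Fin 3 → ℝ) → ℝ} (v w : Fin 3 → ℝ)

theorem dx_eq_dirDeriv : dx = dirDeriv (Pi.single 0 1) := rfl

theorem dy_eq_dirDeriv : dy = dirDeriv (Pi.single 1 1) := rfl

theorem dz_eq_dirDeriv : dz = dirDeriv (Pi.single 2 1) := rfl

theorem ContDiff.dirDeriv (hf : ContDiff ℝ (⊤ : ℕ∞) f) :
    ContDiff ℝ (⊤ : ℕ∞) (dirDeriv v f) :=
  (hf.fderiv_right (m := (⊤ : ℕ∞)) (by simp)).clm_apply contDiff_const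

theorem ContDiff.differentiableAt_of_smooth (hf : ContDiff ℝ (⊤ : ℕ∞) f) (p : Fin 3 → ℝ) :
    DifferentiableAt ℝ f p :=
  (hf.differentiable (by simp)) p

theorem dirDeriv_add (hf : ContDiff ℝ (⊤ : ℕ∞) f) (hu : ContDiff ℝ (⊤ : ℕ∞) u) :
    dirDeriv v (fun y => f y + u y) = fun y => dirDeriv v f y + dirDeriv v u y := by
  funext p
  simp only [dirDeriv]
  rw [fderiv_fun_add (hf.differentiableAt_of_smooth p) (hu.differentiableAt_of_smooth p)]
  rfl

theorem dirDeriv_mul (hf : ContDiff ℝ (⊤ : ℕ∞) f) (hu : ContDiff ℝ (⊤ : ℕ∞) u) :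
    dirDeriv v (fun y => f y * u y) = fun y => dirDeriv v f y * u y + f y * dirDeriv v u y := by
  funext p
  simp only [dirDeriv]
  rw [fderiv_fun_mul (hf.differentiableAt_of_smooth p) (hu.differentiableAt_of_smooth p)]
  simp
  ring

theorem dirDeriv_exp_mul (hg : ContDiff ℝ (⊤ : ℕ∞) g) (hu : ContDiff ℝ (⊤ : ℕ∞) u) :
    dirDeriv v (fun y => Real.exp (g y) * u y) =
      fun y => Real.exp (g y) * (dirDeriv v g y * u y + dirDeriv v u y) := by
  rw [dirDeriv_mul v hg.exp hu]
  funext p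
  simp only [dirDeriv]
  rw [fderiv_exp (hg.differentiableAt_of_smooth p)]
  simp
  ring

theorem dirDeriv_comm (hf : ContDiff ℝ (⊤ : ℕ∞) f) :
    dirDeriv v (dirDeriv w f) = dirDeriv w (dirDeriv v f) := by
  funext p
  have hd : DifferentiableAt ℝ (fderiv ℝ f) p :=
    ((hf.fderiv_right (m := (⊤ : ℕ∞)) (by simp)).differentiable (by simp)) p
  have key : ∀ a b : Fin 3 → ℝ, dirDeriv a (dirDeriv b f) p = fderiv ℝ (fderiv ℝ f) p a b := by
    intro a b
    change fderiv ℝ (fun q => fderiv ℝ f q b) p a = _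
    rw [fderiv_clm_apply hd (differentiableAt_const b)]
    simp
  rw [key, key]
  exact (hf.contDiffAt.isSymmSndFDerivAt (by simpa using WithTop.coe_le_coe.2 (le_top : (2 : ℕ∞) ≤ ⊤))) v w

theorem dirDeriv_const (c : ℝ) : dirDeriv v (fun _ => c) = fun _ => 0 := by
  funext p
  simp [dirDeriv]

theorem contDiff_coord_sub (i : Fin 3) (c : ℝ) :
    ContDiff ℝ (⊤ : ℕ∞) (fun y : Fin 3 → ℝ => y i - c) := by
  fun_prop

theorem dirDeriv_coord_sub (i : Fin 3) (c : ℝ) :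
    dirDeriv v (fun y => y i - c) = fun _ => v i := by
  funext p
  have h : HasFDerivAt (fun y : Fin 3 → ℝ => y i - c)
      (ContinuousLinearMap.proj (R := ℝ) (φ := fun _ : Fin 3 => ℝ) i) p :=
    (ContinuousLinearMap.proj (R := ℝ) (φ := fun _ : Fin 3 => ℝ) i).hasFDerivAt.sub_const c
  simp [dirDeriv, h.fderiv]

theorem dirDeriv_coord_sub_mul (i j : Fin 3) (c d : ℝ) :
    dirDeriv v (fun y => (y i - c) * (y j - d)) =
      fun y => v i * (y j - d) + (y i - c) * v j := by
  rw [dirDeriv_mul v (contDiff_coord_sub i c) (contDiff_coord_sub j d)]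
  simp only [dirDeriv_coord_sub]

theorem dirDeriv_dirDeriv_exp_mul (hg : ContDiff ℝ (⊤ : ℕ∞) g) (hu : ContDiff ℝ (⊤ : ℕ∞) u) :
    dirDeriv v (dirDeriv w (fun y => Real.exp (g y) * u y)) =
      fun y => Real.exp (g y) *
        (dirDeriv v g y * (dirDeriv w g y * u y + dirDeriv w u y)
          + (dirDeriv v (dirDeriv w g) y * u y + dirDeriv w g y * dirDeriv v u y
          + dirDeriv v (dirDeriv w u) y)) := by
  have hwg := hg.dirDeriv w
  have hwu := hu.dirDeriv w
  rw [dirDeriv_exp_mul w hg hu, dirDeriv_exp_mul v hg ((hwg.mul hu).add hwu),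
    dirDeriv_add v (hwg.mul hu) hwu, dirDeriv_mul v hwg hu]

theorem dirDeriv_dirDeriv_dirDeriv_exp_mul (t : Fin 3 → ℝ) (hg : ContDiff ℝ (⊤ : ℕ∞) g)
    (hu : ContDiff ℝ (⊤ : ℕ∞) u) :
    dirDeriv t (dirDeriv v (dirDeriv w (fun y => Real.exp (g y) * u y))) =
      fun y => Real.exp (g y) *
        (dirDeriv t g y * (dirDeriv v g y * (dirDeriv w g y * u y + dirDeriv w u y)
          + (dirDeriv v (dirDeriv w g) y * u y + dirDeriv w g y * dirDeriv v u y
          + dirDeriv v (dirDeriv w u) y))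
        + (dirDeriv t (dirDeriv v g) y * (dirDeriv w g y * u y + dirDeriv w u y)
          + dirDeriv v g y * (dirDeriv t (dirDeriv w g) y * u y + dirDeriv w g y * dirDeriv t u y
            + dirDeriv t (dirDeriv w u) y)
          + (dirDeriv t (dirDeriv v (dirDeriv w g)) y * u y
            + dirDeriv v (dirDeriv w g) y * dirDeriv t u y
            + (dirDeriv t (dirDeriv w g) y * dirDeriv v u y
            + dirDeriv w g y * dirDeriv t (dirDeriv v u) y)
            + dirDeriv t (dirDeriv v (dirDeriv w u)) y))) := by
  have hvg := hg.dirDeriv v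
  have hwg := hg.dirDeriv w
  have hvu := hu.dirDeriv v
  have hwu := hu.dirDeriv w
  have hvwg := hwg.dirDeriv v
  have hvwu := hwu.dirDeriv v
  have h₁ := (hwg.mul hu).add hwu
  have h₂ := (hvwg.mul hu).add (hwg.mul hvu)
  rw [dirDeriv_dirDeriv_exp_mul v w hg hu,
    dirDeriv_exp_mul t hg ((hvg.mul h₁).add (h₂.add hvwu)),
    dirDeriv_add t (hvg.mul h₁) (h₂.add hvwu), dirDeriv_mul t hvg h₁,
    dirDeriv_add t (hwg.mul hu) hwu, dirDeriv_mul t hwg hu, dirDeriv_add t h₂ hvwu,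
    dirDeriv_add t (hvwg.mul hu) (hwg.mul hvu), dirDeriv_mul t hvwg hu, dirDeriv_mul t hwg hvu]

end dirDeriv

theorem symmetric_constant_invariant_xyz
    (a110 a101 a011 a100 a010 a001 a000
     a110' a101' a011' a100' a010' a001' a000' g : (Fin 3 → ℝ) → ℝ)
    (h110 : ContDiff ℝ (⊤ : ℕ∞) a110) (h101 : ContDiff ℝ (⊤ : ℕ∞) a101) (h011 : ContDiff ℝ (⊤ : ℕ∞) a011)
    (h100 : ContDiff ℝ (⊤ : ℕ∞) a100) (h010 : ContDiff ℝ (⊤ : ℕ∞) a010) (h001 : ContDiff ℝ (⊤ : ℕ∞) a001)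
    (h000 : ContDiff ℝ (⊤ : ℕ∞) a000)
    (h110' : ContDiff ℝ (⊤ : ℕ∞) a110') (h101' : ContDiff ℝ (⊤ : ℕ∞) a101') (h011' : ContDiff ℝ (⊤ : ℕ∞) a011')
    (h100' : ContDiff ℝ (⊤ : ℕ∞) a100') (h010' : ContDiff ℝ (⊤ : ℕ∞) a010') (h001' : ContDiff ℝ (⊤ : ℕ∞) a001')
    (h000' : ContDiff ℝ (⊤ : ℕ∞) a000')
    (hg : ContDiff ℝ (⊤ : ℕ∞) g)
    (hgauge : ∀ u : (Fin 3 → ℝ) → ℝ, ContDiff ℝ (⊤ : ℕ∞) u → ∀ x,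
      dx (dy (dz u)) x + a110' x * dx (dy u) x + a101' x * dx (dz u) x
        + a011' x * dy (dz u) x + a100' x * dx u x + a010' x * dy u x
        + a001' x * dz u x + a000' x * u x =
      Real.exp (-(g x)) *
        (dx (dy (dz (fun y => Real.exp (g y) * u y))) x
          + a110 x * dx (dy (fun y => Real.exp (g y) * u y)) x
          + a101 x * dx (dz (fun y => Real.exp (g y) * u y)) x
          + a011 x * dy (dz (fun y => Real.exp (g y) * u y)) x
          + a100 x * dx (fun y => Real.exp (g y) * u y) x
          + a010 x * dy (fun y => Real.exp (g y) * u y) x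
          + a001 x * dz (fun y => Real.exp (g y) * u y) x
          + a000 x * (Real.exp (g x) * u x))) :
    ∀ x, a000' x - (a100' x * a011' x + a010' x * a101' x + a001' x * a110' x
          - 2 * a011' x * a101' x * a110' x
          + (dx (dy a110') x + dx (dz a101') x + dy (dz a011') x) / 3) =
         a000 x - (a100 x * a011 x + a010 x * a101 x + a001 x * a110 x
          - 2 * a011 x * a101 x * a110 x
          + (dx (dy a110) x + dx (dz a101) x + dy (dz a011) x) / 3) := by
  simp only [dx_eq_dirDeriv, dy_eq_dirDeriv, dz_eq_dirDeriv] at hgauge ⊢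
  set X : Fin 3 → ℝ := Pi.single 0 1 with hX
  set Y : Fin 3 → ℝ := Pi.single 1 1 with hY
  set Z : Fin 3 → ℝ := Pi.single 2 1 with hZ
  have expand : ∀ u, ContDiff ℝ (⊤ : ℕ∞) u → ∀ x,
      dirDeriv X (dirDeriv Y (dirDeriv Z u)) x + a110' x * dirDeriv X (dirDeriv Y u) x
        + a101' x * dirDeriv X (dirDeriv Z u) x + a011' x * dirDeriv Y (dirDeriv Z u) x
        + a100' x * dirDeriv X u x + a010' x * dirDeriv Y u x + a001' x * dirDeriv Z u x
        + a000' x * u x =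
      (dirDeriv X g x * (dirDeriv Y g x * (dirDeriv Z g x * u x + dirDeriv Z u x)
          + (dirDeriv Y (dirDeriv Z g) x * u x + dirDeriv Z g x * dirDeriv Y u x
            + dirDeriv Y (dirDeriv Z u) x))
        + (dirDeriv X (dirDeriv Y g) x * (dirDeriv Z g x * u x + dirDeriv Z u x)
          + dirDeriv Y g x * (dirDeriv X (dirDeriv Z g) x * u x + dirDeriv Z g x * dirDeriv X u x
            + dirDeriv X (dirDeriv Z u) x)
          + (dirDeriv X (dirDeriv Y (dirDeriv Z g)) x * u x
            + dirDeriv Y (dirDeriv Z g) x * dirDeriv X u x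
            + (dirDeriv X (dirDeriv Z g) x * dirDeriv Y u x
              + dirDeriv Z g x * dirDeriv X (dirDeriv Y u) x)
            + dirDeriv X (dirDeriv Y (dirDeriv Z u)) x)))
        + a110 x * (dirDeriv X g x * (dirDeriv Y g x * u x + dirDeriv Y u x)
          + (dirDeriv X (dirDeriv Y g) x * u x + dirDeriv Y g x * dirDeriv X u x
            + dirDeriv X (dirDeriv Y u) x))
        + a101 x * (dirDeriv X g x * (dirDeriv Z g x * u x + dirDeriv Z u x)
          + (dirDeriv X (dirDeriv Z g) x * u x + dirDeriv Z g x * dirDeriv X u x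
            + dirDeriv X (dirDeriv Z u) x))
        + a011 x * (dirDeriv Y g x * (dirDeriv Z g x * u x + dirDeriv Z u x)
          + (dirDeriv Y (dirDeriv Z g) x * u x + dirDeriv Z g x * dirDeriv Y u x
            + dirDeriv Y (dirDeriv Z u) x))
        + a100 x * (dirDeriv X g x * u x + dirDeriv X u x)
        + a010 x * (dirDeriv Y g x * u x + dirDeriv Y u x)
        + a001 x * (dirDeriv Z g x * u x + dirDeriv Z u x)
        + a000 x * u x := by
    intro u hu x
    have h := hgauge u hu x
    rw [dirDeriv_dirDeriv_dirDeriv_exp_mul Y Z X hg hu, dirDeriv_dirDeriv_exp_mul X Y hg hu,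
      dirDeriv_dirDeriv_exp_mul X Z hg hu, dirDeriv_dirDeriv_exp_mul Y Z hg hu,
      dirDeriv_exp_mul X hg hu, dirDeriv_exp_mul Y hg hu, dirDeriv_exp_mul Z hg hu] at h
    simp only [mul_left_comm _ (Real.exp (g x)), ← mul_add] at h
    rwa [← mul_assoc, ← Real.exp_add, add_neg_cancel, Real.exp_zero, one_mul] at h
  have hX0 : X 0 = 1 := by simp [hX]
  have hX1 : X 1 = 0 := by simp [hX]
  have hX2 : X 2 = 0 := by simp [hX]
  have hY0 : Y 0 = 0 := by simp [hY]
  have hY1 : Y 1 = 1 := by simp [hY]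
  have hY2 : Y 2 = 0 := by simp [hY]
  have hZ0 : Z 0 = 0 := by simp [hZ]
  have hZ1 : Z 1 = 0 := by simp [hZ]
  have hZ2 : Z 2 = 1 := by simp [hZ]
  have e110 : a110' = fun x => a110 x + dirDeriv Z g x := by
    funext p
    have h := expand (fun y => (y 0 - p 0) * (y 1 - p 1))
      ((contDiff_coord_sub 0 _).mul (contDiff_coord_sub 1 _)) p
    simp only [dirDeriv_coord_sub_mul, dirDeriv_coord_sub, dirDeriv_const, sub_self, mul_zero,
      zero_mul, add_zero, zero_add, mul_one, one_mul, hX0, hX1, hX2, hY0, hY1,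
      hY2, hZ0, hZ1, hZ2] at h
    linarith
  have e101 : a101' = fun x => a101 x + dirDeriv Y g x := by
    funext p
    have h := expand (fun y => (y 0 - p 0) * (y 2 - p 2))
      ((contDiff_coord_sub 0 _).mul (contDiff_coord_sub 2 _)) p
    simp only [dirDeriv_coord_sub_mul, dirDeriv_coord_sub, dirDeriv_const, sub_self, mul_zero,
      zero_mul, add_zero, zero_add, mul_one, one_mul, hX0, hX1, hX2, hY0, hY1,
      hY2, hZ0, hZ1, hZ2] at h
    linarith
  have e011 : a011' = fun x => a011 x + dirDeriv X g x := by
    funext p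
    have h := expand (fun y => (y 1 - p 1) * (y 2 - p 2))
      ((contDiff_coord_sub 1 _).mul (contDiff_coord_sub 2 _)) p
    simp only [dirDeriv_coord_sub_mul, dirDeriv_coord_sub, dirDeriv_const, sub_self, mul_zero,
      zero_mul, add_zero, zero_add, mul_one, one_mul, hX0, hX1, hX2, hY0, hY1,
      hY2, hZ0, hZ1, hZ2] at h
    linarith
  intro p
  have e100 := expand (fun y => y 0 - p 0) (contDiff_coord_sub 0 _) p
  have e010 := expand (fun y => y 1 - p 1) (contDiff_coord_sub 1 _) p
  have e001 := expand (fun y => y 2 - p 2) (contDiff_coord_sub 2 _) p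
  simp only [dirDeriv_coord_sub, dirDeriv_const, sub_self, hX0, hX1, hX2, hY0, hY1, hY2, hZ0,
    hZ1, hZ2, mul_zero, mul_one, zero_add, add_zero] at e100 e010 e001
  have e000 := expand (fun _ => 1) contDiff_const p
  simp only [dirDeriv_const, mul_zero, mul_one, zero_add, add_zero] at e000
  have hXY : dirDeriv X (dirDeriv Z (dirDeriv Y g)) = dirDeriv X (dirDeriv Y (dirDeriv Z g)) := by
    rw [dirDeriv_comm Z Y hg]
  have hYX : dirDeriv Y (dirDeriv Z (dirDeriv X g)) = dirDeriv X (dirDeriv Y (dirDeriv Z g)) := by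
    rw [dirDeriv_comm Z X hg, dirDeriv_comm Y X (hg.dirDeriv Z)]
  rw [e000, e100, e010, e001, e110, e101, e011,
    dirDeriv_add Y h110 (hg.dirDeriv Z),
    dirDeriv_add X (h110.dirDeriv Y) ((hg.dirDeriv Z).dirDeriv Y),
    dirDeriv_add Z h101 (hg.dirDeriv Y),
    dirDeriv_add X (h101.dirDeriv Z) ((hg.dirDeriv Y).dirDeriv Z),
    dirDeriv_add Z h011 (hg.dirDeriv X),
    dirDeriv_add Y (h011.dirDeriv Z) ((hg.dirDeriv X).dirDeriv Z),
    hXY, hYX]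
  ring
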